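/- For every n ≥ 1, the map π from Γ_{n+1} to Γ_n deleting the last letter of a word is a 2-sheeted normal (Galois) covering of Schreier graphs of the Basilica group with Galois group ℤ/2ℤ. Precisely: (i) π(s(w)) = s(π(w)) for every generator s ∈ {a,a⁻¹,b,b⁻¹} and every word w of length n+1; (ii) the last-letter flip σ (mapping u·x to u·(1−x)) satisfies s(σ(w)) = σ(s(w)) for every generator s and every word w of length n+1, so σ is a graph automorphism of Γ_{n+1}; (iii) σ∘σ = id, σ has no fixed point, π∘σ = π, and {id, σ} acts transitively on each fiber π⁻¹(u) = {u·0, u·1}. -/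

import Mathlib

mutual
/-- The generator `a` of the Basilica group: `a(0w)=0·b(w)`, `a(1w)=1·w`. -/
def basA : List (Fin 2) → List (Fin 2)
  | [] => []
  | x :: w => if x = 0 then 0 :: basB w else 1 :: w
/-- The generator `b`: `b(0w)=1·a(w)`, `b(1w)=0·w`. -/
def basB : List (Fin 2) → List (Fin 2)
  | [] => []
  | x :: w => if x = 0 then 1 :: basA w else 0 :: w
end

mutual
/-- The inverse generator `a⁻¹`: `a⁻¹(0w)=0·b⁻¹(w)`, `a⁻¹(1w)=1·w`. -/
def basAinv : List (Fin 2) → List (Fin 2)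
  | [] => []
  | x :: w => if x = 0 then 0 :: basBinv w else 1 :: w
/-- The inverse generator `b⁻¹`: `b⁻¹(1w)=0·a⁻¹(w)`, `b⁻¹(0w)=1·w`. -/
def basBinv : List (Fin 2) → List (Fin 2)
  | [] => []
  | x :: w => if x = 1 then 0 :: basAinv w else 1 :: w
end

/-- The last-letter flip `σ`, mapping `u·x` to `u·(1-x)`. -/
def flipLast (w : List (Fin 2)) : List (Fin 2) :=
  w.dropLast ++ [1 - w.getLastD 0]

/-- On each cylinder `u·x` the map `s` acts on the prefix by itself and translates the last letter
by an amount depending only on `u`. -/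
def TranslatesLast (s : List (Fin 2) → List (Fin 2)) : Prop :=
  ∀ u, ∃ c : Fin 2, ∀ x, s (u ++ [x]) = s u ++ [x + c]

theorem translatesLast_basA_basB (u : List (Fin 2)) :
    (∃ c : Fin 2, ∀ x, basA (u ++ [x]) = basA u ++ [x + c]) ∧
      ∃ c : Fin 2, ∀ x, basB (u ++ [x]) = basB u ++ [x + c] := by
  induction u with
  | nil => exact ⟨⟨0, by simp [basA, basB, Fin.forall_fin_two]⟩,
      ⟨1, by simp [basA, basB, Fin.forall_fin_two]⟩⟩
  | cons y u ih =>
    obtain ⟨⟨c, hc⟩, d, hd⟩ := ih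
    by_cases hy : y = 0
    · exact ⟨⟨d, fun x => by simp [basA, hy, hd]⟩, ⟨c, fun x => by simp [basB, hy, hc]⟩⟩
    · exact ⟨⟨0, fun x => by simp [basA, hy]⟩, ⟨0, fun x => by simp [basB, hy]⟩⟩

theorem translatesLast_basAinv_basBinv (u : List (Fin 2)) :
    (∃ c : Fin 2, ∀ x, basAinv (u ++ [x]) = basAinv u ++ [x + c]) ∧
      ∃ c : Fin 2, ∀ x, basBinv (u ++ [x]) = basBinv u ++ [x + c] := by
  induction u with
  | nil => exact ⟨⟨0, by simp [basAinv, basBinv, Fin.forall_fin_two]⟩,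
      ⟨1, by simp [basAinv, basBinv, Fin.forall_fin_two]⟩⟩
  | cons y u ih =>
    obtain ⟨⟨c, hc⟩, d, hd⟩ := ih
    constructor
    · by_cases hy : y = 0
      · exact ⟨d, fun x => by simp [basAinv, hy, hd]⟩
      · exact ⟨0, fun x => by simp [basAinv, hy]⟩
    · by_cases hy : y = 1
      · exact ⟨c, fun x => by simp [basBinv, hy, hc]⟩
      · exact ⟨0, fun x => by simp [basBinv, hy]⟩

theorem translatesLast_of_mem {s : List (Fin 2) → List (Fin 2)}
    (hs : s ∈ [basA, basAinv, basB, basBinv]) : TranslatesLast s := by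
  simp only [List.mem_cons, List.not_mem_nil, or_false] at hs
  rcases hs with rfl | rfl | rfl | rfl
  · exact fun u => (translatesLast_basA_basB u).1
  · exact fun u => (translatesLast_basAinv_basBinv u).1
  · exact fun u => (translatesLast_basA_basB u).2
  · exact fun u => (translatesLast_basAinv_basBinv u).2

theorem flipLast_append_singleton (u : List (Fin 2)) (x : Fin 2) :
    flipLast (u ++ [x]) = u ++ [1 - x] := by
  simp [flipLast]

theorem TranslatesLast.dropLast_comm {s : List (Fin 2) → List (Fin 2)} (hs : TranslatesLast s)
    (u : List (Fin 2)) (x : Fin 2) : (s (u ++ [x])).dropLast = s (u ++ [x]).dropLast := by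
  obtain ⟨c, hc⟩ := hs u
  simp [hc]

theorem TranslatesLast.flipLast_comm {s : List (Fin 2) → List (Fin 2)} (hs : TranslatesLast s)
    (u : List (Fin 2)) (x : Fin 2) : s (flipLast (u ++ [x])) = flipLast (s (u ++ [x])) := by
  obtain ⟨c, hc⟩ := hs u
  have sub_add : ∀ x c : Fin 2, 1 - x + c = 1 - (x + c) := by decide
  rw [flipLast_append_singleton, hc, hc, flipLast_append_singleton, sub_add]

theorem exists_eq_append_singleton {α : Type*} {n : ℕ} {w : List α} (hw : w.length = n + 1) :
    ∃ u x, w = u ++ [x] :=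
  (List.eq_nil_or_concat' w).resolve_left (by rintro rfl; simp at hw)

/-- For every `n ≥ 1`, deleting the last letter is a 2-sheeted normal (Galois) covering
`Γ_{n+1} → Γ_n` of Schreier graphs of the Basilica group, with Galois group `ℤ/2ℤ`
generated by the last-letter flip `σ = flipLast`. -/
theorem basilica_galois_covering (n : ℕ) (hn : 1 ≤ n) :
    (∀ s ∈ [basA, basAinv, basB, basBinv], ∀ w : List (Fin 2), w.length = n + 1 →
        (s w).dropLast = s w.dropLast) ∧
    (∀ s ∈ [basA, basAinv, basB, basBinv], ∀ w : List (Fin 2), w.length = n + 1 →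
        s (flipLast w) = flipLast (s w)) ∧
    (∀ w : List (Fin 2), w.length = n + 1 → flipLast (flipLast w) = w) ∧
    (∀ w : List (Fin 2), w.length = n + 1 → flipLast w ≠ w) ∧
    (∀ w : List (Fin 2), w.length = n + 1 → (flipLast w).dropLast = w.dropLast) ∧
    (∀ u : List (Fin 2), u.length = n → ∀ w : List (Fin 2),
        (w.length = n + 1 ∧ w.dropLast = u) ↔ (w = u ++ [0] ∨ w = u ++ [1])) ∧
    (∀ w w' : List (Fin 2), w.length = n + 1 → w'.length = n + 1 →
        w.dropLast = w'.dropLast → w' = w ∨ w' = flipLast w) := by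
  refine ⟨fun s hs w hw => ?_, fun s hs w hw => ?_, fun w hw => ?_, fun w hw => ?_,
    fun w _ => by simp [flipLast], fun u hu w => ⟨?_, ?_⟩, fun w w' hw hw' h => ?_⟩
  · obtain ⟨u, x, rfl⟩ := exists_eq_append_singleton hw
    exact (translatesLast_of_mem hs).dropLast_comm u x
  · obtain ⟨u, x, rfl⟩ := exists_eq_append_singleton hw
    exact (translatesLast_of_mem hs).flipLast_comm u x
  · obtain ⟨u, x, rfl⟩ := exists_eq_append_singleton hw
    simp [flipLast_append_singleton]
  · obtain ⟨u, x, rfl⟩ := exists_eq_append_singleton hw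
    have sub_ne : ∀ x : Fin 2, 1 - x ≠ x := by decide
    simpa [flipLast_append_singleton] using sub_ne x
  · rintro ⟨hw, rfl⟩
    obtain ⟨u, x, rfl⟩ := exists_eq_append_singleton hw
    have eq_or : ∀ x : Fin 2, x = 0 ∨ x = 1 := by decide
    simpa using eq_or x
  · rintro (rfl | rfl) <;> simp [hu]
  · obtain ⟨u, x, rfl⟩ := exists_eq_append_singleton hw
    obtain ⟨v, y, rfl⟩ := exists_eq_append_singleton hw'
    obtain rfl : u = v := by simpa using h
    have eq_or : ∀ x y : Fin 2, y = x ∨ y = 1 - x := by decide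
    simpa [flipLast_append_singleton] using eq_or x y
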